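/- Let P ⊆ ℝ² be the convex hull of the seven points (cos(2πk/7), sin(2πk/7)) for k = 0,…,6 (a regular heptagon). Then there exists a convex hexagon Q with P ⊆ Q and |Q| ≤ (1 + tan(2π/7)/(7·cos(π/7)))·|P|. -/

import Mathlib

open MeasureTheory Real

/-- A convex `n`-gon in the plane: the convex hull of a finite set of at most `n` points,
having nonempty interior. -/
def IsConvexPolygon (n : ℕ) (Q : Set (ℝ × ℝ)) : Prop :=
  ∃ S : Finset (ℝ × ℝ), S.card ≤ n ∧ Q = convexHull ℝ (S : Set (ℝ × ℝ)) ∧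
    (interior Q).Nonempty

/-- The isosceles triangle with apex `(a, 0)`, sides of slopes `±m` and base on the line `x = b`
has area at most `m * (b - a) ^ 2`. -/
theorem volume_isosceles_triangle_le {a b m : ℝ} (hab : a ≤ b) (hm : 0 < m) :
    volume {p : ℝ × ℝ | p.1 ≤ b ∧ |p.2| ≤ m * (p.1 - a)} ≤ ENNReal.ofReal (m * (b - a) ^ 2) := by
  have hmeas : MeasurableSet {p : ℝ × ℝ | p.1 ≤ b ∧ |p.2| ≤ m * (p.1 - a)} := by
    apply IsClosed.measurableSet
    rw [Set.ofPred_and]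
    exact (isClosed_le (by fun_prop) (by fun_prop)).inter
      (isClosed_le (by fun_prop) (by fun_prop))
  rw [Measure.volume_eq_prod, Measure.prod_apply hmeas]
  calc ∫⁻ x, volume (Prod.mk x ⁻¹' {p : ℝ × ℝ | p.1 ≤ b ∧ |p.2| ≤ m * (p.1 - a)})
      ≤ ∫⁻ x, (Set.Icc a b).indicator (fun x ↦ ENNReal.ofReal (2 * m * (x - a))) x := by
        refine lintegral_mono fun x ↦ ?_
        by_cases hx : x ∈ Set.Icc a b
        · rw [Set.indicator_of_mem hx]
          calc _ ≤ volume (Set.Icc (-(m * (x - a))) (m * (x - a))) :=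
                measure_mono fun y hy ↦ Set.mem_Icc.2 (abs_le.1 hy.2)
            _ = _ := by rw [Real.volume_Icc]; congr 1; ring
        · rw [Set.indicator_of_notMem hx, nonpos_iff_eq_zero, ← nonpos_iff_eq_zero,
            ← measure_empty (μ := (volume : Measure ℝ))]
          refine measure_mono fun y hy ↦ hx ⟨?_, hy.1⟩
          have h0 : 0 ≤ m * (x - a) := (abs_nonneg y).trans hy.2
          linarith [nonneg_of_mul_nonneg_right h0 hm]
    _ = ENNReal.ofReal (∫ x in Set.Icc a b, 2 * m * (x - a)) := by
        rw [lintegral_indicator measurableSet_Icc, ofReal_integral_eq_lintegral_ofReal]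
        · exact (by fun_prop : Continuous fun x : ℝ ↦ 2 * m * (x - a)).integrableOn_Icc
        · filter_upwards [ae_restrict_mem measurableSet_Icc] with x hx
          have := hx.1
          exact mul_nonneg (by positivity) (by linarith)
    _ = ENNReal.ofReal (m * (b - a) ^ 2) := by
        congr 1
        rw [integral_Icc_eq_integral_Ioc, ← intervalIntegral.integral_of_le hab,
          intervalIntegral.integral_const_mul,
          intervalIntegral.integral_comp_sub_right (fun x : ℝ ↦ x) a, integral_id]
        ring

theorem Convex.Icc_prod_Icc_subset {K : Set (ℝ × ℝ)} (hK : Convex ℝ K) {a b c d : ℝ}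
    (hab : a ≤ b) (hcd : c ≤ d) (h₁ : (a, c) ∈ K) (h₂ : (a, d) ∈ K) (h₃ : (b, c) ∈ K)
    (h₄ : (b, d) ∈ K) : Set.Icc a b ×ˢ Set.Icc c d ⊆ K := by
  rw [← segment_eq_Icc hab, ← segment_eq_Icc hcd, ← convexHull_pair, ← convexHull_pair,
    ← convexHull_prod]
  refine convexHull_min ?_ hK
  rintro ⟨x, y⟩ ⟨hx, hy⟩
  simp only [Set.mem_insert_iff, Set.mem_singleton_iff] at hx hy
  rcases hx with rfl | rfl <;> rcases hy with rfl | rfl <;> assumption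

/-- A point of a convex set `K` on a vertical line lies between two points of `K`. -/
theorem Convex.mk_mem_of_mem_Icc {K : Set (ℝ × ℝ)} (hK : Convex ℝ K) {x y c d : ℝ}
    (h₁ : (x, c) ∈ K) (h₂ : (x, d) ∈ K) (hy : y ∈ Set.Icc c d) : (x, y) ∈ K :=
  hK.Icc_prod_Icc_subset le_rfl (hy.1.trans hy.2) h₁ h₂ h₁ h₂ ⟨⟨le_rfl, le_rfl⟩, hy⟩

/-- Removing the vertical edge `x = b` of a convex set `K` by extending the two neighbouring edges
to their common point `(a, 0)` adds at most a triangle. -/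
theorem convexHull_insert_apex_subset {K V : Set (ℝ × ℝ)} (hK : Convex ℝ K) {a b m : ℝ}
    (hab : a < b) (hV : V.Nonempty) (hVK : V ⊆ K) (hVb : ∀ p ∈ V, b < p.1)
    (hVm : ∀ p ∈ V, |p.2| ≤ m * (p.1 - a))
    (h₁ : (b, -(m * (b - a))) ∈ K) (h₂ : (b, m * (b - a)) ∈ K) :
    convexHull ℝ (insert (a, 0) V) ⊆
      K ∪ {p : ℝ × ℝ | p.1 ≤ b ∧ |p.2| ≤ m * (p.1 - a)} := by
  intro q hq
  rw [convexHull_insert hV, mem_convexJoin] at hq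
  obtain ⟨_, rfl, p, hp, u, v, hu, hv, huv, rfl⟩ := hq
  have hpK : p ∈ K := convexHull_min hVK hK hp
  have hpb : b < p.1 := by
    have hc : Convex ℝ {p : ℝ × ℝ | b < p.1} :=
      convex_halfSpace_gt (LinearMap.fst ℝ ℝ ℝ).isLinear b
    exact convexHull_min (t := {p : ℝ × ℝ | b < p.1}) hVb hc hp
  have hpm : |p.2| ≤ m * (p.1 - a) := by
    have hc : Convex ℝ {p : ℝ × ℝ | |p.2| ≤ m * (p.1 - a)} := by
      intro x hx y hy u v hu hv huv
      simp only [Set.mem_ofPred_eq, Prod.snd_add, Prod.smul_snd, Prod.fst_add, Prod.smul_fst,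
        smul_eq_mul, abs_le] at *
      obtain rfl : v = 1 - u := by linarith
      constructor <;> nlinarith
    exact convexHull_min (t := {p : ℝ × ℝ | |p.2| ≤ m * (p.1 - a)}) hVm hc hp
  obtain ⟨x, y⟩ := p
  simp only at hpb hpm
  obtain rfl : u = 1 - v := by linarith
  by_cases hqb : (1 - v) * a + v * x ≤ b
  · right
    simp only [Set.mem_ofPred_eq, Prod.snd_add, Prod.smul_snd, Prod.fst_add, Prod.smul_fst,
        smul_eq_mul, abs_le] at *
    refine ⟨hqb, ?_, ?_⟩ <;> nlinarith
  · left
    push Not at hqb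
    have hxa : 0 < x - a := by linarith
    have hxb : 0 < x - b := by linarith
    set w := (b - a) / (x - a) with hw
    have hw0 : 0 ≤ w := div_nonneg (by linarith) hxa.le
    have hwx : w * (x - a) = b - a := div_mul_cancel₀ _ hxa.ne'
    have hmid : (b, w * y) ∈ K := by
      refine hK.mk_mem_of_mem_Icc h₁ h₂ ?_
      have : |w * y| ≤ m * (b - a) := by
        rw [abs_mul, abs_of_nonneg hw0, ← hwx]
        nlinarith
      exact abs_le.1 this
    have hw1 : 0 < 1 - w := by
      have : w < 1 := by rw [hw, div_lt_one hxa]; linarith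
      linarith
    have hvw : 0 ≤ v - w := by
      by_contra! h
      nlinarith
    convert hK hmid hpK (a := (1 - v) / (1 - w)) (b := (v - w) / (1 - w))
      (div_nonneg hu hw1.le) (div_nonneg hvw hw1.le) (by field_simp; ring) using 1
    have hb : b = a + w * (x - a) := by linarith
    ext
    · simp only [Prod.fst_add, Prod.smul_fst, smul_eq_mul]
      rw [hb]; field_simp; ring
    · simp only [Prod.snd_add, Prod.smul_snd, smul_eq_mul]
      field_simp; ring

theorem sin_pi_div_seven_mem_Ioo : sin (π / 7) ∈ Set.Ioo (0.426 : ℝ) 0.449 := by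
  have h₁ := pi_gt_d2
  have h₂ := pi_lt_d4
  have hlt : sin (π / 7) < π / 7 := sin_lt (by positivity)
  have hgt := sin_gt_sub_cube (x := π / 7) (by positivity)
  have hcube : (π / 7) ^ 3 ≤ (0.4488 : ℝ) ^ 3 := by gcongr; linarith
  constructor
  · norm_num at hcube ⊢; linarith
  · norm_num; linarith

/-- The coordinates of the regular heptagon, with `c + s * I = exp (π * I / 7)`. -/
theorem exists_heptagon_coords : ∃ c s C S D E : ℝ,
    c = cos (π / 7) ∧ s = sin (π / 7) ∧ C = 2 * c ^ 2 - 1 ∧ S = 2 * s * c ∧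
    D = 2 * C ^ 2 - 1 ∧ E = 2 * S * C ∧ E * S = D * C + c ∧ 0 < c ∧
    tan (2 * π / 7) = S / C ∧
    {p : ℝ × ℝ | ∃ k : Fin 7, p = (cos (2 * π * k / 7), sin (2 * π * k / 7))} =
      {(-c, s), (-c, -s), (1, 0), (C, S), (C, -S), (D, E), (D, -E)} := by
  have hC : cos (2 * π / 7) = 2 * cos (π / 7) ^ 2 - 1 := by rw [← cos_two_mul]; ring_nf
  have hS : sin (2 * π / 7) = 2 * sin (π / 7) * cos (π / 7) := by rw [← sin_two_mul]; ring_nf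
  have hD : cos (4 * π / 7) = 2 * cos (2 * π / 7) ^ 2 - 1 := by rw [← cos_two_mul]; ring_nf
  have hE : sin (4 * π / 7) = 2 * sin (2 * π / 7) * cos (2 * π / 7) := by
    rw [← sin_two_mul]; ring_nf
  have hc : cos (6 * π / 7) = -cos (π / 7) := by rw [← cos_pi_sub]; ring_nf
  have hs : sin (6 * π / 7) = sin (π / 7) := by rw [← sin_pi_sub]; ring_nf
  refine ⟨_, _, _, _, _, _, rfl, rfl, hC, hS, hD, hE, ?_, ?_, tan_eq_sin_div_cos _, ?_⟩
  · have := cos_add (4 * π / 7) (2 * π / 7)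
    rw [show 4 * π / 7 + 2 * π / 7 = 6 * π / 7 by ring, hc] at this
    linarith
  · exact cos_pos_of_mem_Ioo ⟨by linarith [pi_pos], by linarith [pi_pos]⟩
  · have hcr (x : ℝ) : cos (2 * π - x) = cos x := cos_two_pi_sub x
    have hsr (x : ℝ) : sin (2 * π - x) = -sin x := sin_two_pi_sub x
    have e0 : 2 * π * ((0 : Fin 7) : ℕ) / 7 = 0 := by simp
    have e1 : 2 * π * ((1 : Fin 7) : ℕ) / 7 = 2 * π / 7 := by simp
    have e2 : 2 * π * ((2 : Fin 7) : ℕ) / 7 = 4 * π / 7 := by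
      rw [show ((2 : Fin 7) : ℕ) = 2 from rfl]; push_cast; ring
    have e3 : 2 * π * ((3 : Fin 7) : ℕ) / 7 = 6 * π / 7 := by
      rw [show ((3 : Fin 7) : ℕ) = 3 from rfl]; push_cast; ring
    have e4 : 2 * π * ((4 : Fin 7) : ℕ) / 7 = 2 * π - 6 * π / 7 := by
      rw [show ((4 : Fin 7) : ℕ) = 4 from rfl]; push_cast; ring
    have e5 : 2 * π * ((5 : Fin 7) : ℕ) / 7 = 2 * π - 4 * π / 7 := by
      rw [show ((5 : Fin 7) : ℕ) = 5 from rfl]; push_cast; ring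
    have e6 : 2 * π * ((6 : Fin 7) : ℕ) / 7 = 2 * π - 2 * π / 7 := by
      rw [show ((6 : Fin 7) : ℕ) = 6 from rfl]; push_cast; ring
    ext p
    simp only [Set.mem_ofPred_eq, Set.mem_insert_iff, Set.mem_singleton_iff, Fin.exists_fin_succ,
      Fin.exists_fin_zero, or_false]
    change p = (cos (2 * π * ((0 : Fin 7) : ℕ) / 7), sin (2 * π * ((0 : Fin 7) : ℕ) / 7)) ∨
      p = (cos (2 * π * ((1 : Fin 7) : ℕ) / 7), sin (2 * π * ((1 : Fin 7) : ℕ) / 7)) ∨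
      p = (cos (2 * π * ((2 : Fin 7) : ℕ) / 7), sin (2 * π * ((2 : Fin 7) : ℕ) / 7)) ∨
      p = (cos (2 * π * ((3 : Fin 7) : ℕ) / 7), sin (2 * π * ((3 : Fin 7) : ℕ) / 7)) ∨
      p = (cos (2 * π * ((4 : Fin 7) : ℕ) / 7), sin (2 * π * ((4 : Fin 7) : ℕ) / 7)) ∨
      p = (cos (2 * π * ((5 : Fin 7) : ℕ) / 7), sin (2 * π * ((5 : Fin 7) : ℕ) / 7)) ∨
      p = (cos (2 * π * ((6 : Fin 7) : ℕ) / 7), sin (2 * π * ((6 : Fin 7) : ℕ) / 7)) ↔ _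
    rw [e0, e1, e2, e3, e4, e5, e6]
    simp only [hcr, hsr, hc, hs, cos_zero, sin_zero]
    tauto

theorem heptagon_coords_bounds {c s C S D E : ℝ} (hc0 : 0 < c) (hsl : 0.426 < s)
    (hsu : s < 0.449) (hcs : c ^ 2 = 1 - s ^ 2) (hC : C = 2 * c ^ 2 - 1) (hS : S = 2 * s * c)
    (hD : D = 2 * C ^ 2 - 1) (hE : E = 2 * S * C) :
    0.89 < c ∧ 0.59 < C ∧ D < -0.18 ∧ -0.31 < D ∧ 0 < s ∧ 0 < S ∧ s < S ∧ S < E ∧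
      S ^ 2 = 1 - C ^ 2 ∧ s * S = c - c * C ∧ 7 * s ≤ 4 * (C - D) := by
  norm_num at hsl hsu
  have hs0 : 0 < s := by linarith
  have hcl : 0.89 < c := by norm_num; nlinarith
  have hCl : 0.59 < C := by norm_num; nlinarith
  have hCu : C < 0.64 := by norm_num; nlinarith
  have hDu : D < -0.18 := by norm_num at hCl hCu ⊢; nlinarith
  have hDl : -0.31 < D := by norm_num at hCl hCu ⊢; nlinarith
  have hS0 : 0 < S := by rw [hS]; positivity
  have hs2 : s ^ 2 = 1 - c ^ 2 := by linarith
  refine ⟨hcl, hCl, hDu, hDl, hs0, hS0, ?_, ?_, ?_, ?_, ?_⟩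
  · norm_num at hcl; nlinarith
  · norm_num at hCl; nlinarith
  · rw [hS, hC]; linear_combination 4 * c ^ 2 * hs2
  · rw [hS, hC]; linear_combination 2 * c * hs2
  · norm_num at hCl hCu; nlinarith

/-- The regular heptagon is contained in a convex hexagon of area at most
`1 + tan(2π/7)/(7·cos(π/7))` times the heptagon's area. -/
theorem regular_heptagon_in_hexagon
    (P : Set (ℝ × ℝ))
    (hP : P = convexHull ℝ
      {p : ℝ × ℝ | ∃ k : Fin 7, p = (cos (2 * π * k / 7), sin (2 * π * k / 7))}) :
    ∃ Q : Set (ℝ × ℝ), IsConvexPolygon 6 Q ∧ P ⊆ Q ∧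
      volume Q ≤ ENNReal.ofReal (1 + tan (2 * π / 7) / (7 * cos (π / 7))) * volume P := by
  obtain ⟨c, s, C, S, D, E, hc, hs, hC, hS, hD, hE, hES, hc0, htan, hset⟩ :=
    exists_heptagon_coords
  rw [htan, ← hc]
  rw [hset] at hP
  obtain ⟨hsl, hsu⟩ := sin_pi_div_seven_mem_Ioo
  rw [← hs] at hsl hsu
  have hcs : c ^ 2 = 1 - s ^ 2 := by rw [hc, hs, cos_sq']
  clear hset htan hs hc
  obtain ⟨hcl, hCl, hDu, hDl, hs0, hS0, hsS, hSE, hSC, hss, h7⟩ :=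
    heptagon_coords_bounds hc0 hsl hsu hcs hC hS hD hE
  have hC0 : 0 < C := by linarith
  have hE0 : 0 < E := by linarith
  -- The apex is `(a, 0)`, and the extended edges have slopes `±m`.
  obtain ⟨a, ha⟩ : ∃ a, a = -c / C := ⟨_, rfl⟩
  obtain ⟨m, hm⟩ : ∃ m, m = C / S := ⟨_, rfl⟩
  have hm0 : 0 < m := by rw [hm]; positivity
  have hline (x : ℝ) : m * (x - a) = (x * C + c) / S := by rw [hm, ha]; field_simp; ring
  have hac : a < -c := by rw [ha, div_lt_iff₀ hC0]; nlinarith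
  have hbase : m * (-c - a) = s := by rw [hline, div_eq_iff hS0.ne']; linarith
  have hED : m * (D - a) = E := by rw [hline, div_eq_iff hS0.ne']; linarith
  obtain ⟨V, hV⟩ : ∃ V : Set (ℝ × ℝ), V = {(1, 0), (C, S), (C, -S), (D, E), (D, -E)} := ⟨_, rfl⟩
  have hPV : P = convexHull ℝ (insert (-c, s) (insert (-c, -s) V)) := by rw [hP, hV]
  have hPc : Convex ℝ P := hP ▸ convex_convexHull ℝ _
  have hsub : insert (-c, s) (insert (-c, -s) V) ⊆ P := hPV ▸ subset_convexHull ℝ _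
  have hVP : V ⊆ P := fun p hp ↦ hsub (by simp [hp])
  have hrect : Set.Icc D C ×ˢ Set.Icc (-S) S ⊆ P := by
    have h₁ : (D, E) ∈ P := hVP (by simp [hV])
    have h₂ : (D, -E) ∈ P := hVP (by simp [hV])
    exact hPc.Icc_prod_Icc_subset (by linarith) (by linarith)
      (hPc.mk_mem_of_mem_Icc h₂ h₁ ⟨by linarith, by linarith⟩)
      (hPc.mk_mem_of_mem_Icc h₂ h₁ ⟨by linarith, by linarith⟩)
      (hVP (by simp [hV])) (hVP (by simp [hV]))
  have hQ := subset_convexHull ℝ (insert (a, 0) V)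
  have hedge (y : ℝ) (hy : (D, y * E) ∈ V) : (-c, y * s) ∈ convexHull ℝ (insert (a, 0) V) := by
    have h := convex_convexHull ℝ (insert (a, 0) V) (hQ (Set.mem_insert _ _))
      (hQ (Set.mem_insert_of_mem _ hy)) (a := 1 - s / E) (b := s / E)
      (by rw [sub_nonneg, div_le_one hE0]; linarith) (by positivity) (by ring)
    convert h using 1
    ext
    · simp only [Prod.fst_add, Prod.smul_fst, smul_eq_mul]
      rw [← hbase, ← hED]
      have : D - a ≠ 0 := by linarith
      field_simp
      ring
    · simp only [Prod.snd_add, Prod.smul_snd, smul_eq_mul]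
      field_simp
      ring
  have hPQ : P ⊆ convexHull ℝ (insert (a, 0) V) := by
    rw [hPV]
    refine convexHull_min ?_ (convex_convexHull ℝ _)
    refine Set.insert_subset ?_ (Set.insert_subset ?_ ((Set.subset_insert _ _).trans hQ))
    · simpa using hedge 1 (by simp [hV])
    · simpa using hedge (-1) (by simp [hV])
  refine ⟨convexHull ℝ (insert (a, 0) V), ⟨{(a, 0), (1, 0), (C, S), (C, -S), (D, E), (D, -E)},
    Finset.card_le_six, by simp [hV], ?_⟩, hPQ, ?_⟩
  · refine Set.Nonempty.mono (interior_mono (hrect.trans hPQ)) ?_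
    rw [interior_prod_eq, interior_Icc, interior_Icc]
    exact (Set.nonempty_Ioo.2 (by linarith)).prod (Set.nonempty_Ioo.2 (by linarith))
  have hcover := convexHull_insert_apex_subset hPc (m := m) hac (by simp [hV]) hVP
    (by simp only [hV, Set.mem_insert_iff, Set.mem_singleton_iff, forall_eq_or_imp, forall_eq]
        refine ⟨?_, ?_, ?_, ?_, ?_⟩ <;> linarith)
    (by simp only [hV, Set.mem_insert_iff, Set.mem_singleton_iff, forall_eq_or_imp, forall_eq,
          abs_neg, abs_of_pos hS0, abs_of_pos hE0, hED, le_refl, and_true, abs_zero]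
        rw [hline, hline, le_div_iff₀ hS0, le_div_iff₀ hS0]
        refine ⟨?_, ?_, ?_⟩ <;> nlinarith)
    (hbase ▸ hsub (by simp)) (hbase ▸ hsub (by simp))
  have harea : m * (-c - a) ^ 2 ≤ S / C / (7 * c) * ((C - D) * (S - -S)) := by
    have h₁ : -c - a = s / m := by rw [eq_div_iff hm0.ne']; linarith
    have h₂ : m * (-c - a) ^ 2 = s ^ 2 * S / C := by rw [h₁, hm]; field_simp
    have h₃ : S / C / (7 * c) * ((C - D) * (S - -S)) = s * S / C * (4 * (C - D) / 7) := by
      rw [hS]; field_simp; ring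
    have h₄ : s ^ 2 * S / C = s * S / C * s := by ring
    rw [h₂, h₃, h₄]
    gcongr
    linarith
  have hr : 0 ≤ S / C / (7 * c) := by positivity
  calc volume (convexHull ℝ (insert (a, 0) V))
      ≤ volume P + volume {p : ℝ × ℝ | p.1 ≤ -c ∧ |p.2| ≤ m * (p.1 - a)} :=
        (measure_mono hcover).trans (measure_union_le _ _)
    _ ≤ volume P + ENNReal.ofReal (S / C / (7 * c)) *
          volume (Set.Icc D C ×ˢ Set.Icc (-S) S) := by
        gcongr
        rw [Measure.volume_eq_prod, Measure.prod_prod, Real.volume_Icc, Real.volume_Icc,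
          ← ENNReal.ofReal_mul (by linarith), ← ENNReal.ofReal_mul hr]
        exact (volume_isosceles_triangle_le hac.le hm0).trans (ENNReal.ofReal_le_ofReal harea)
    _ ≤ volume P + ENNReal.ofReal (S / C / (7 * c)) * volume P := by
        gcongr
    _ = ENNReal.ofReal (1 + S / C / (7 * c)) * volume P := by
        rw [ENNReal.ofReal_add zero_le_one hr, ENNReal.ofReal_one, add_mul, one_mul]
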